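/- Suppose weights are degree-monotone in a generating tuple ⟨μ,d⟩ and a directed tree T ∈ ℛ(μ,d) contains an arc mm′ between internal vertices with d_T(m) − d_T(m′) > 0. Then there exists a directed tree T′ ∈ ℛ(μ,d) such that f(T′) strictly weakly majorizes f(T), i.e., f(T′) ≻^w f(T). -/

import Mathlib

open scoped Classical
noncomputable section

/-- A directed tree on a finite vertex set `V`: each vertex has an outbound arc to its
`parent`, the `root` is a fixed point of `parent` (i.e. has no genuine outbound arc), and
every vertex reaches the root by iterating `parent`. -/
structure DirTree (V : Type) [Fintype V] [DecidableEq V] where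
  root : V
  parent : V → V
  parent_root : parent root = root
  reaches : ∀ v, ∃ n, parent^[n] v = root

variable {V : Type} [Fintype V] [DecidableEq V]

namespace DirTree

/-- `u` belongs to the subordinate group of `v`: there is a directed path from `u` to `v`. -/
def Desc (T : DirTree V) (u v : V) : Prop := ∃ n, T.parent^[n] u = v

/-- The set of vertices with an arc to `v`. -/
def children (T : DirTree V) (v : V) : Finset V :=
  Finset.univ.filter fun u => T.parent u = v ∧ u ≠ v

/-- Weight `f_T(v)` of the subordinate group of `v`. -/
def f (T : DirTree V) (μ : V → ℝ) (v : V) : ℝ :=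
  ∑ u ∈ Finset.univ.filter (fun u => T.Desc u v), μ u

/-- Degree of `v` in the underlying undirected tree. -/
def deg (T : DirTree V) (v : V) : ℕ :=
  (T.children v).card + (if v = T.root then 0 else 1)

/-- The underlying undirected tree. -/
def toGraph (T : DirTree V) : SimpleGraph V :=
  SimpleGraph.fromRel fun u v => T.parent u = v ∧ u ≠ v

/-- The vector (as a multiset, i.e. up to ascending rearrangement) of subordinate
groups' weights of internal non-root vertices. -/
def fvec (T : DirTree V) (μ : V → ℝ) : Multiset ℝ :=
  (Finset.univ.filter fun m => 1 < T.deg m ∧ m ≠ T.root).val.map (T.f μ)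

end DirTree

/-- Degree of a vertex in a simple graph. -/
def gdeg (G : SimpleGraph V) (v : V) : ℕ :=
  (Finset.univ.filter fun u => G.Adj v u).card

/-- `⟨μ, d⟩` is a generating tuple: nonnegative weights, degrees at least 1 summing to
`2(|V|-1)`, at least two pendent and at least one internal vertex. -/
structure IsGenTuple (μ : V → ℝ) (d : V → ℕ) : Prop where
  nonneg : ∀ v, 0 ≤ μ v
  deg_pos : ∀ v, 1 ≤ d v
  sum_deg : ∑ v, d v = 2 * (Fintype.card V - 1)
  two_le_pendent : 2 ≤ (Finset.univ.filter fun v => d v = 1).card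
  one_le_internal : 1 ≤ (Finset.univ.filter fun v => 1 < d v).card

/-- Weights are degree-monotone in `⟨μ, d⟩`. -/
def DegMonotone (μ : V → ℝ) (d : V → ℕ) : Prop :=
  (∀ m m', 1 < d m → 1 < d m' → d m < d m' → μ m ≤ μ m') ∧
  ∀ v, d v = 1 → 0 < μ v

/-- `T ∈ ℛ(μ,d)`: directed tree with internal root whose (undirected) degrees match `d`. -/
def memR (T : DirTree V) (d : V → ℕ) : Prop :=
  1 < d T.root ∧ ∀ v, T.deg v = d v

/-- `G ∈ 𝒯(μ,d)`: `G` is a tree whose degrees match `d`. -/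
def memT (G : SimpleGraph V) (d : V → ℕ) : Prop :=
  G.IsTree ∧ ∀ v, gdeg G v = d v

/-- Vertex-weighted Wiener index. -/
def VWWI (μ : V → ℝ) (G : SimpleGraph V) : ℝ :=
  (1 / 2) * ∑ u, ∑ v, μ u * μ v * (G.dist u v : ℝ)

/-- `S = (m, L)` is a minimal star for the state `(U, μ, d)`: the center `m` is an
internal vertex of `U` of least degree among internal vertices of least weight, and the
`d m - 1` leaves `L` are pendent vertices of `U` of least weights. -/
def IsMinimalStar (U : Finset V) (μ : V → ℝ) (d : V → ℕ) (m : V) (L : Finset V) : Prop :=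
  m ∈ U ∧ 1 < d m ∧ L ⊆ U ∧ m ∉ L ∧ L.card = d m - 1 ∧
  (∀ v ∈ L, d v = 1) ∧
  (∀ m' ∈ U, 1 < d m' → μ m ≤ μ m') ∧
  (∀ m' ∈ U, 1 < d m' → μ m' = μ m → d m ≤ d m') ∧
  ∀ u ∈ L, ∀ w ∈ U, d w = 1 → w ∉ L → μ u ≤ μ w

/-- Centers used before step `i` (0-indexed). -/
def usedCenters {q : ℕ} (c : Fin q → V) (i : ℕ) : Finset V :=
  (Finset.univ.filter fun j : Fin q => (j : ℕ) < i).image c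

/-- Vertex set `V_{i+1}` of the state of the Huffman algorithm before (0-indexed) step `i`,
for the candidate Huffman tree `T` with star centers `c`. -/
def stateV (T : DirTree V) {q : ℕ} (c : Fin q → V) (i : ℕ) : Finset V :=
  Finset.univ \ (Finset.univ.filter fun j : Fin q => (j : ℕ) < i).biUnion fun j => T.children (c j)

/-- Weight function `μ^{i+1}` of the state before (0-indexed) step `i`. -/
def stateMu (T : DirTree V) (μ : V → ℝ) {q : ℕ} (c : Fin q → V) (i : ℕ) : V → ℝ :=
  fun v => if v ∈ usedCenters c i then T.f μ v else μ v

/-- Degree function `d^{i+1}` of the state before (0-indexed) step `i`. -/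
def stateD (d : V → ℕ) {q : ℕ} (c : Fin q → V) (i : ℕ) : V → ℕ :=
  fun v => if v ∈ usedCenters c i then 1 else d v

/-- `T` is a directed Huffman tree for `⟨μ, d⟩` whose star sequence has centers
`c 0, …, c (q-1)` (so `S_i` has leaf set `children (c i)`): the centers enumerate the
internal vertices, the root is the last center, and at each of the first `q - 1` steps
the corresponding star is a minimal star of the current state. -/
def IsHuffmanSeq (μ : V → ℝ) (d : V → ℕ) (T : DirTree V) {q : ℕ} (c : Fin q → V) : Prop :=
  (∀ v, T.deg v = d v) ∧
  Function.Injective c ∧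
  (∀ v, 1 < d v ↔ ∃ j, c j = v) ∧
  (∀ hq : 0 < q, T.root = c ⟨q - 1, Nat.sub_lt hq Nat.one_pos⟩) ∧
  ∀ i : Fin q, (i : ℕ) < q - 1 →
    IsMinimalStar (stateV T c (i : ℕ)) (stateMu T μ c (i : ℕ)) (stateD d c (i : ℕ))
      (c i) (T.children (c i))

/-- `T ∈ ℛℋ(μ,d)`: `T` is a directed Huffman tree for `⟨μ, d⟩`. -/
def IsHuffmanDir (μ : V → ℝ) (d : V → ℕ) (T : DirTree V) : Prop :=
  ∃ (q : ℕ) (c : Fin q → V), IsHuffmanSeq μ d T c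

/-- Sum of the `k` smallest components of a multiset of reals. -/
def ascSum (s : Multiset ℝ) (k : ℕ) : ℝ := ((s.sort (· ≤ ·)).take k).sum

/-- `x` weakly majorizes `y` (`y ⪯^w x`). -/
def WMaj (x y : Multiset ℝ) : Prop :=
  Multiset.card x = Multiset.card y ∧ ∀ k, ascSum x k ≤ ascSum y k

/-- `x` strictly weakly majorizes `y` (`y ≺^w x`). -/
def SWMaj (x y : Multiset ℝ) : Prop := WMaj x y ∧ x ≠ y

namespace List

theorem forall₂_le_orderedInsert (l : List ℝ) (hl : l.Pairwise (· ≤ ·)) {a b : ℝ} (hab : a ≤ b) :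
    Forall₂ (· ≤ ·) (l.orderedInsert (· ≤ ·) a) (l.orderedInsert (· ≤ ·) b) := by
  induction l generalizing a b with
  | nil => simpa using hab
  | cons c l ih =>
    rw [pairwise_cons] at hl
    have hrefl : Forall₂ (· ≤ ·) l l := forall₂_refl l
    by_cases hac : a ≤ c
    · by_cases hbc : b ≤ c
      · rw [orderedInsert_cons_of_le _ _ hac, orderedInsert_cons_of_le _ _ hbc]
        exact .cons hab (.cons le_rfl hrefl)
      · have hins : l.orderedInsert (· ≤ ·) c = c :: l := by
          cases l with
          | nil => rfl
          | cons e l => exact orderedInsert_cons_of_le _ _ (hl.1 e (by simp))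
        rw [orderedInsert_cons_of_le _ _ hac, orderedInsert_of_not_le _ _ hbc, ← hins]
        exact .cons hac (ih hl.2 (not_le.1 hbc).le)
    · have hbc : ¬ b ≤ c := fun h => hac (hab.trans h)
      rw [orderedInsert_of_not_le _ _ hac, orderedInsert_of_not_le _ _ hbc]
      exact .cons le_rfl (ih hl.2 hab)

end List

theorem Multiset.sort_cons_eq_orderedInsert (a : ℝ) (s : Multiset ℝ) :
    (a ::ₘ s).sort (· ≤ ·) = (s.sort (· ≤ ·)).orderedInsert (· ≤ ·) a := by
  refine List.Perm.eq_of_pairwise' (Multiset.pairwise_sort _ _)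
    ((Multiset.pairwise_sort s _).orderedInsert a _) ?_
  rw [← Multiset.coe_eq_coe, Multiset.sort_eq,
    Multiset.coe_eq_coe.2 (List.perm_orderedInsert _ _ _), ← Multiset.cons_coe, Multiset.sort_eq]

theorem SWMaj.cons_of_lt {a b : ℝ} (hab : a < b) (s : Multiset ℝ) :
    SWMaj (a ::ₘ s) (b ::ₘ s) := by
  refine ⟨⟨by simp, fun k => ?_⟩, fun h => hab.ne ((Multiset.cons_inj_left s).1 h)⟩
  rw [ascSum, ascSum, Multiset.sort_cons_eq_orderedInsert, Multiset.sort_cons_eq_orderedInsert]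
  exact (List.forall₂_take k (List.forall₂_le_orderedInsert _
    (Multiset.pairwise_sort _ _) hab.le)).sum_le_sum

namespace DirTree

theorem induction_on (T : DirTree V) {P : V → Prop} (root : P T.root)
    (step : ∀ v, v ≠ T.root → P (T.parent v) → P v) (v : V) : P v := by
  obtain ⟨n, hn⟩ := T.reaches v
  induction n generalizing v with
  | zero => exact (show v = T.root from hn) ▸ root
  | succ n ih =>
    by_cases hv : v = T.root
    · exact hv ▸ root
    · exact step v hv (ih _ hn)

theorem Desc.refl (T : DirTree V) (v : V) : T.Desc v v := ⟨0, rfl⟩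

theorem desc_iff (T : DirTree V) (u v : V) : T.Desc u v ↔ u = v ∨ T.Desc (T.parent u) v := by
  constructor
  · rintro ⟨n, hn⟩
    cases n with
    | zero => exact Or.inl hn
    | succ n => exact Or.inr ⟨n, hn⟩
  · rintro (rfl | ⟨n, hn⟩)
    · exact Desc.refl T u
    · exact ⟨n + 1, hn⟩

theorem Desc.trans {T : DirTree V} {u v w : V} (h : T.Desc u v) (h' : T.Desc v w) :
    T.Desc u w := by
  obtain ⟨n, rfl⟩ := h
  obtain ⟨k, rfl⟩ := h'
  exact ⟨k + n, Function.iterate_add_apply _ _ _ _⟩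

theorem desc_parent (T : DirTree V) (u : V) : T.Desc u (T.parent u) := ⟨1, rfl⟩

theorem desc_root_iff (T : DirTree V) (v : V) : T.Desc T.root v ↔ T.root = v := by
  constructor
  · rintro ⟨n, rfl⟩
    exact (Function.iterate_fixed T.parent_root n).symm
  · rintro rfl
    exact Desc.refl T _

theorem Desc.antisymm {T : DirTree V} {u v : V} (h : T.Desc u v) (h' : T.Desc v u) : u = v := by
  induction u using T.induction_on generalizing v with
  | root => exact (T.desc_root_iff v).1 h
  | step u hu ih =>
    by_contra huv
    have hpv : T.Desc (T.parent u) v := ((T.desc_iff u v).1 h).resolve_left huv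
    have hpu : T.parent u = v := ih hpv (h'.trans (T.desc_parent u))
    have hvp : T.Desc (T.parent v) u := ((T.desc_iff v u).1 h').resolve_left (Ne.symm huv)
    have := ih (v := u) (hpu ▸ h') (T.desc_parent u)
    exact huv (this.symm.trans hpu)

theorem Desc.total {T : DirTree V} {u v w : V} (h : T.Desc u v) (h' : T.Desc u w) :
    T.Desc v w ∨ T.Desc w v := by
  obtain ⟨n, rfl⟩ := h
  obtain ⟨k, rfl⟩ := h'
  rcases le_total n k with hnk | hnk
  · exact Or.inl ⟨k - n, by rw [← Function.iterate_add_apply, Nat.sub_add_cancel hnk]⟩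
  · exact Or.inr ⟨n - k, by rw [← Function.iterate_add_apply, Nat.sub_add_cancel hnk]⟩

theorem parent_ne (T : DirTree V) {v : V} (hv : v ≠ T.root) : T.parent v ≠ v := by
  intro h
  obtain ⟨n, hn⟩ := T.reaches v
  exact hv ((Function.iterate_fixed h n).symm.trans hn)

theorem parent_parent_ne (T : DirTree V) {v : V} (hv : v ≠ T.root) :
    T.parent (T.parent v) ≠ v := fun h =>
  T.parent_ne hv (Desc.antisymm (T.desc_parent v) ⟨1, h⟩).symm

theorem exists_desc_children_eq_empty (T : DirTree V) (v : V) :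
    ∃ w, T.Desc w v ∧ T.children w = ∅ := by
  obtain ⟨w, hw, hmin⟩ := Finset.exists_min_image (Finset.univ.filter fun u => T.Desc u v)
    (fun u => (Finset.univ.filter fun x => T.Desc x u).card) ⟨v, by simp [Desc.refl]⟩
  simp only [Finset.mem_filter, Finset.mem_univ, true_and] at hw hmin
  refine ⟨w, hw, Finset.eq_empty_of_forall_notMem fun x hx => ?_⟩
  simp only [children, Finset.mem_filter, Finset.mem_univ, true_and] at hx
  have hxw : T.Desc x w := ⟨1, hx.1⟩
  refine (hmin x (hxw.trans hw)).not_gt (Finset.card_lt_card ?_)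
  refine Finset.ssubset_iff_subset_ne.2 ⟨fun y hy => ?_, fun h => ?_⟩
  · simp only [Finset.mem_filter, Finset.mem_univ, true_and] at hy ⊢
    exact hy.trans hxw
  · have : w ∈ Finset.univ.filter fun y => T.Desc y x := h ▸ by simp [Desc.refl]
    simp only [Finset.mem_filter, Finset.mem_univ, true_and] at this
    exact hx.2 (hxw.antisymm this)

/-- The parent map after exchanging `m` with its parent, where the children in `S` of `m` stay
at the lower position, now taken by the former parent of `m`. -/
def exchangeParent (T : DirTree V) (m : V) (S : Finset V) (v : V) : V :=
  if v = T.parent m then m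
  else if v = m then (if T.parent m = T.root then m else T.parent (T.parent m))
  else if v ∈ S then T.parent m
  else if T.parent v = T.parent m ∨ T.parent v = m then m
  else T.parent v

theorem parent_eq_of_mem_children {T : DirTree V} {u v : V} (h : u ∈ T.children v) :
    T.parent u = v := by
  simp only [children, Finset.mem_filter] at h
  exact h.2.1

theorem exchangeParent_cases (T : DirTree V) {m : V} (hm : m ≠ T.root) {S : Finset V}
    (hS : S ⊆ T.children m) (v : V) :
    (v = T.parent m ∧ T.exchangeParent m S v = m) ∨
    (v = m ∧ T.parent m = T.root ∧ T.exchangeParent m S v = m) ∨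
    (v = m ∧ T.parent m ≠ T.root ∧ T.exchangeParent m S v = T.parent (T.parent m)) ∨
    (v ≠ T.parent m ∧ v ≠ m ∧
      ((v ∈ S ∧ T.parent v = m ∧ T.exchangeParent m S v = T.parent m) ∨
      (v ∉ S ∧ T.parent v = T.parent m ∧ T.exchangeParent m S v = m) ∨
      (v ∉ S ∧ T.parent v = m ∧ T.exchangeParent m S v = m) ∨
      (v ∉ S ∧ T.parent v ≠ m ∧ T.parent v ≠ T.parent m ∧
        T.exchangeParent m S v = T.parent v))) := by
  have h2 := T.parent_ne hm
  have h3 : v ∈ S → T.parent v = m := fun hv => parent_eq_of_mem_children (hS hv)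
  unfold exchangeParent
  by_cases h4 : v = T.parent m
  · exact Or.inl ⟨h4, if_pos h4⟩
  by_cases h5 : v = m
  · subst h5
    by_cases h6 : T.parent v = T.root
    · simp [h6]
    · simp [h4, h6]
  by_cases h6 : v ∈ S
  · simp [h4, h5, h6, h3 h6]
  by_cases h7 : T.parent v = m
  · simp [h4, h5, h6, h7]
  by_cases h8 : T.parent v = T.parent m <;> simp [h4, h5, h6, h7, h8]

/-- Exchange `m` with its parent, leaving the children in `S` at the lower position. -/
def exchange (T : DirTree V) (m : V) (hm : m ≠ T.root) (S : Finset V) (hS : S ⊆ T.children m) :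
    DirTree V where
  root := if T.parent m = T.root then m else T.root
  parent := T.exchangeParent m S
  parent_root := by
    have h1 := T.parent_root
    have := T.exchangeParent_cases hm hS m
    have := T.exchangeParent_cases hm hS T.root
    grind
  reaches := by
    have hm' := T.parent_ne hm
    set r := if T.parent m = T.root then m else T.root with hr
    suffices ∀ R : V → Prop, (∀ v, R v ↔ v = r ∨ R (T.exchangeParent m S v)) → ∀ v, R v by
      refine this _ fun v => ⟨?_, ?_⟩
      · rintro ⟨n, hn⟩
        cases n with
        | zero => exact Or.inl hn
        | succ n => exact Or.inr ⟨n, hn⟩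
      · rintro (rfl | ⟨n, hn⟩)
        · exact ⟨0, rfl⟩
        · exact ⟨n + 1, hn⟩
    intro R hR v
    have hRm := hR m
    have hRm' := hR (T.parent m)
    have hem := T.exchangeParent_cases hm hS m
    have hem' := T.exchangeParent_cases hm hS (T.parent m)
    have hRr := hR r
    clear_value r
    induction v using T.induction_on with
    | root =>
      have := hR T.root
      clear hR
      grind
    | step v hv ih =>
      have := hR v
      have := T.exchangeParent_cases hm hS v
      clear hR
      grind

section exchange

variable (T : DirTree V) {m : V} (hm : m ≠ T.root) {S : Finset V} (hS : S ⊆ T.children m)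

theorem exchange_parent_cases (v : V) :
    (v = T.parent m ∧ (T.exchange m hm S hS).parent v = m) ∨
    (v = m ∧ T.parent m = T.root ∧ (T.exchange m hm S hS).parent v = m) ∨
    (v = m ∧ T.parent m ≠ T.root ∧ (T.exchange m hm S hS).parent v = T.parent (T.parent m)) ∨
    (v ≠ T.parent m ∧ v ≠ m ∧
      ((v ∈ S ∧ T.parent v = m ∧ (T.exchange m hm S hS).parent v = T.parent m) ∨
      (v ∉ S ∧ T.parent v = T.parent m ∧ (T.exchange m hm S hS).parent v = m) ∨
      (v ∉ S ∧ T.parent v = m ∧ (T.exchange m hm S hS).parent v = m) ∨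
      (v ∉ S ∧ T.parent v ≠ m ∧ T.parent v ≠ T.parent m ∧
        (T.exchange m hm S hS).parent v = T.parent v))) :=
  T.exchangeParent_cases hm hS v

theorem exchange_root :
    (T.exchange m hm S hS).root = if T.parent m = T.root then m else T.root := rfl

theorem exchange_desc_iff {v : V} (hvm : v ≠ m) (hvm' : v ≠ T.parent m) (u : V) :
    (T.exchange m hm S hS).Desc u v ↔ T.Desc u v := by
  have h1 := T.parent_root
  have hm' := T.parent_ne hm
  have hr := T.exchange_root hm hS
  have hem := T.exchange_parent_cases hm hS m
  have hem' := T.exchange_parent_cases hm hS (T.parent m)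
  have hdr := T.desc_root_iff v
  set T' := T.exchange m hm S hS
  have hdr' := T'.desc_root_iff v
  have d1 := T.desc_iff m v
  have d1' := T'.desc_iff m v
  have d2 := T.desc_iff (T.parent m) v
  have d2' := T'.desc_iff (T.parent m) v
  induction u using T.induction_on with
  | root => grind
  | step u hu ih =>
    have := T.desc_iff u v
    have := T'.desc_iff u v
    have := T.exchange_parent_cases hm hS u
    grind

theorem exchange_desc_self_iff (u : V) :
    (T.exchange m hm S hS).Desc u m ↔ T.Desc u (T.parent m) := by
  have h1 := T.parent_root
  have hm' := T.parent_ne hm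
  have hr := T.exchange_root hm hS
  have hem := T.exchange_parent_cases hm hS m
  have hem' := T.exchange_parent_cases hm hS (T.parent m)
  have hdr := T.desc_root_iff (T.parent m)
  have c1 := T.desc_parent m
  have c2 := Desc.refl T (T.parent m)
  set T' := T.exchange m hm S hS
  have hdr' := T'.desc_root_iff m
  have c3 := Desc.refl T' m
  have c4 := T'.desc_iff (T.parent m) m
  induction u using T.induction_on with
  | root =>
    have := T'.desc_iff T.root m
    grind
  | step u hu ih =>
    have := T.desc_iff u (T.parent m)
    have := T'.desc_iff u m
    have := T.exchange_parent_cases hm hS u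
    grind

theorem exchange_parent_parent : (T.exchange m hm S hS).parent (T.parent m) = m := by
  have hm' := T.parent_ne hm
  have hem' := T.exchange_parent_cases hm hS (T.parent m)
  grind

theorem not_exchange_desc_self_parent : ¬ (T.exchange m hm S hS).Desc m (T.parent m) := fun h =>
  T.parent_ne hm (h.antisymm ⟨1, T.exchange_parent_parent hm hS⟩).symm

theorem desc_of_exchange_desc_parent {u : V} (h : (T.exchange m hm S hS).Desc u (T.parent m)) :
    u = T.parent m ∨ T.Desc u m := by
  have hnot := T.not_exchange_desc_self_parent hm hS
  have hm' := T.parent_ne hm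
  have hr := T.exchange_root hm hS
  have c1 := Desc.refl T m
  set T' := T.exchange m hm S hS
  induction u using T.induction_on with
  | root =>
    have := T'.desc_root_iff (T.parent m)
    grind
  | step u hu ih =>
    have := T.desc_iff u m
    have := T'.desc_iff u (T.parent m)
    have := T.exchange_parent_cases hm hS u
    grind

theorem not_exchange_desc_parent {x u : V} (hx : x ∈ T.children m) (hxS : x ∉ S)
    (hu : T.Desc u x) : ¬ (T.exchange m hm S hS).Desc u (T.parent m) := by
  intro h
  have hxm := parent_eq_of_mem_children hx
  have hx1 : x ≠ m := by
    rintro rfl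
    exact T.parent_ne hm hxm
  have hx2 : x ≠ T.parent m := by
    rintro rfl
    exact T.parent_parent_ne hm hxm
  have hpx : (T.exchange m hm S hS).parent x = m := by
    have := T.exchange_parent_cases hm hS x
    grind
  have hnot := T.not_exchange_desc_self_parent hm hS
  rcases ((T.exchange_desc_iff hm hS hx1 hx2 u).2 hu).total h with h' | h'
  · rw [desc_iff, hpx] at h'
    exact h'.elim hx2 hnot
  · rw [desc_iff, T.exchange_parent_parent hm hS] at h'
    exact h'.elim hx2.symm fun h' => hx1.symm (h'.antisymm ⟨1, hpx⟩)

theorem exchange_f_of_ne (μ : V → ℝ) {v : V} (hvm : v ≠ m) (hvm' : v ≠ T.parent m) :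
    (T.exchange m hm S hS).f μ v = T.f μ v := by
  simp only [f, T.exchange_desc_iff hm hS hvm hvm']

theorem exchange_f_self (μ : V → ℝ) : (T.exchange m hm S hS).f μ m = T.f μ (T.parent m) := by
  simp only [f, T.exchange_desc_self_iff hm hS]

theorem exchange_f_parent_lt {μ : V → ℝ} (hμ : ∀ v, 0 ≤ μ v) (hle : μ (T.parent m) ≤ μ m)
    {x l : V} (hx : x ∈ T.children m) (hxS : x ∉ S) (hl : T.Desc l x) (hlpos : 0 < μ l) :
    (T.exchange m hm S hS).f μ (T.parent m) < T.f μ m := by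
  have hxm := parent_eq_of_mem_children hx
  have hlx := T.not_exchange_desc_parent hm hS hx hxS hl
  have hlm : l ≠ m := by
    rintro rfl
    exact T.parent_ne hm ((Desc.antisymm ⟨1, hxm⟩ hl) ▸ hxm)
  set D := Finset.univ.filter fun u => T.Desc u m with hD
  have hmD : m ∈ D := by simp [hD, Desc.refl]
  have hlD : l ∈ D.erase m := by
    simp only [hD, Finset.mem_erase, Finset.mem_filter, Finset.mem_univ, true_and]
    exact ⟨hlm, hl.trans ⟨1, hxm⟩⟩
  have hsub : (Finset.univ.filter fun u => (T.exchange m hm S hS).Desc u (T.parent m)) ⊆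
      insert (T.parent m) ((D.erase m).erase l) := by
    intro u hu
    simp only [Finset.mem_filter, Finset.mem_univ, true_and] at hu
    simp only [hD, Finset.mem_insert, Finset.mem_erase, Finset.mem_filter, Finset.mem_univ,
      true_and]
    rcases T.desc_of_exchange_desc_parent hm hS hu with h | h
    · exact Or.inl h
    · refine Or.inr ⟨?_, ?_, h⟩
      · rintro rfl
        exact hlx hu
      · rintro rfl
        exact T.not_exchange_desc_self_parent hm hS hu
  have hnot : T.parent m ∉ (D.erase m).erase l := by
    simp only [hD, Finset.mem_erase, Finset.mem_filter, Finset.mem_univ, true_and]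
    exact fun h => T.parent_ne hm (h.2.2.antisymm (T.desc_parent m))
  have h1 := Finset.sum_le_sum_of_subset_of_nonneg hsub fun u _ _ => hμ u
  rw [Finset.sum_insert hnot] at h1
  have h2 := Finset.add_sum_erase D μ hmD
  have h3 := Finset.add_sum_erase (D.erase m) μ hlD
  simp only [f, ← hD]
  linarith

theorem exchange_children_parent : (T.exchange m hm S hS).children (T.parent m) = S := by
  have hm' := T.parent_ne hm
  have hpp := T.parent_parent_ne hm
  ext u
  have := T.exchange_parent_cases hm hS u
  have h3 : ∀ v, v ∈ S → T.parent v = m := fun v hv => parent_eq_of_mem_children (hS hv)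
  have h3u := h3 u
  have h3' := h3 (T.parent m)
  have h4 := T.parent_ne (v := T.parent m)
  simp only [children, Finset.mem_filter, Finset.mem_univ, true_and]
  grind

theorem exchange_children_self : (T.exchange m hm S hS).children m =
    insert (T.parent m) ((T.children (T.parent m)).erase m ∪ (T.children m \ S)) := by
  have hm' := T.parent_ne hm
  have hpp := T.parent_parent_ne hm
  ext u
  have := T.exchange_parent_cases hm hS u
  have h3 : ∀ v, v ∈ S → T.parent v = m := fun v hv => parent_eq_of_mem_children (hS hv)
  have h3u := h3 u
  have h4 := T.parent_ne (v := m)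
  simp only [children, Finset.mem_filter, Finset.mem_univ, true_and, Finset.mem_insert,
    Finset.mem_union, Finset.mem_erase, Finset.mem_sdiff]
  grind

theorem exchange_children_of_ne {v : V} (hvm : v ≠ m) (hvm' : v ≠ T.parent m) :
    (T.exchange m hm S hS).children v =
      (T.children v).map (Equiv.swap m (T.parent m)).toEmbedding := by
  have hm' := T.parent_ne hm
  have h1 := T.parent_root
  ext u
  have := T.exchange_parent_cases hm hS u
  simp only [Finset.mem_map_equiv, Equiv.symm_swap, children, Finset.mem_filter, Finset.mem_univ,
    true_and]
  rcases eq_or_ne u m with rfl | hum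
  · rw [Equiv.swap_apply_left]
    grind
  rcases eq_or_ne u (T.parent m) with rfl | hum'
  · rw [Equiv.swap_apply_right]
    grind
  · rw [Equiv.swap_apply_of_ne_of_ne hum hum']
    grind

theorem exchange_deg (hcard : S.card + 1 = T.deg (T.parent m)) (v : V) :
    (T.exchange m hm S hS).deg v = T.deg v := by
  have hm' := T.parent_ne hm
  have hr := T.exchange_root hm hS
  rcases eq_or_ne v m with rfl | hvm
  · have hmem : v ∈ T.children (T.parent v) := by simp [children, hm'.symm]
    have hsum := Finset.card_erase_add_one hmem
    have hsd := Finset.card_sdiff_add_card_eq_card hS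
    have hdisj : Disjoint ((T.children (T.parent v)).erase v) (T.children v \ S) := by
      rw [Finset.disjoint_left]
      intro u hu hu'
      have e1 := parent_eq_of_mem_children (Finset.mem_of_mem_erase hu)
      have e2 := parent_eq_of_mem_children (Finset.mem_sdiff.1 hu').1
      exact hm' (e1.symm.trans e2)
    have hnot : T.parent v ∉ (T.children (T.parent v)).erase v ∪ (T.children v \ S) := by
      rw [Finset.mem_union, not_or]
      refine ⟨fun h => ?_, fun h => ?_⟩
      · simp [children] at h
      · exact T.parent_parent_ne hm (parent_eq_of_mem_children (Finset.mem_sdiff.1 h).1)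
    unfold deg at *
    rw [T.exchange_children_self hm hS, Finset.card_insert_of_notMem hnot,
      Finset.card_union_of_disjoint hdisj, hr]
    grind
  rcases eq_or_ne v (T.parent m) with rfl | hvm'
  · have : (T.exchange m hm S hS).root ≠ T.parent m := by grind
    rw [← hcard, deg, T.exchange_children_parent hm hS, if_neg this.symm]
  · have : v = (T.exchange m hm S hS).root ↔ v = T.root := by grind
    simp only [deg, T.exchange_children_of_ne hm hS hvm hvm', Finset.card_map, this]

theorem exchange_fvec_SWMaj {μ : V → ℝ} (hcard : S.card + 1 = T.deg (T.parent m))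
    (hdm : 1 < T.deg m) (hdm' : 1 < T.deg (T.parent m))
    (hlt : (T.exchange m hm S hS).f μ (T.parent m) < T.f μ m) :
    SWMaj ((T.exchange m hm S hS).fvec μ) (T.fvec μ) := by
  have hm' := T.parent_ne hm
  have hr := T.exchange_root hm hS
  set T' := T.exchange m hm S hS 
  have hroot' : T.parent m ≠ T'.root := by grind
  set A := (Finset.univ.filter fun v => 1 < T.deg v ∧ v ≠ T.root) with hA
  set B := (Finset.univ.filter fun v => 1 < T'.deg v ∧ v ≠ T'.root) with hB
  have hmA : m ∈ A := by simp [hA, hdm, hm]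
  have hdeg : ∀ v, T'.deg v = T.deg v := T.exchange_deg hm hS hcard
  have hmB : T.parent m ∈ B := by simp [hB, hdeg, hdm', hroot']
  have hBA : B.erase (T.parent m) = (A.erase m).map (Equiv.swap m (T.parent m)).toEmbedding := by
    ext u
    simp only [hA, hB, hdeg, Finset.mem_map_equiv, Equiv.symm_swap, Finset.mem_erase,
      Finset.mem_filter, Finset.mem_univ, true_and]
    rcases eq_or_ne u m with rfl | hum
    · rw [Equiv.swap_apply_left]
      grind
    rcases eq_or_ne u (T.parent m) with rfl | hum'
    · rw [Equiv.swap_apply_right]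
      grind
    · rw [Equiv.swap_apply_of_ne_of_ne hum hum']
      grind
  have hrest : (B.erase (T.parent m)).val.map (T'.f μ) = (A.erase m).val.map (T.f μ) := by
    rw [hBA, Finset.map_val, Multiset.map_map]
    refine Multiset.map_congr rfl fun u hu => ?_
    have hum : u ≠ m := (Finset.mem_erase.1 hu).1
    rcases eq_or_ne u (T.parent m) with rfl | hum'
    · simpa using T.exchange_f_self hm hS μ
    · simpa [Equiv.swap_apply_of_ne_of_ne hum hum'] using T.exchange_f_of_ne hm hS μ hum hum'
  have hfA : T.fvec μ = T.f μ m ::ₘ (A.erase m).val.map (T.f μ) := by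
    rw [← Multiset.map_cons, ← Finset.insert_val_of_notMem (Finset.notMem_erase m A),
      Finset.insert_erase hmA]
    rfl
  have hfB : T'.fvec μ = T'.f μ (T.parent m) ::ₘ (B.erase (T.parent m)).val.map (T'.f μ) := by
    rw [← Multiset.map_cons, ← Finset.insert_val_of_notMem (Finset.notMem_erase (T.parent m) B),
      Finset.insert_erase hmB]
    rfl
  rw [hfA, hfB, hrest]
  exact SWMaj.cons_of_lt hlt _

end exchange

end DirTree

/-- under degree-monotone weights, if `T` contains an arc `mm'` between
internal vertices with `d_T(m) > d_T(m')`, then some tree of `ℛ(μ,d)` has a vector of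
subordinate groups' weights strictly weakly majorizing that of `T`. -/
theorem exchange_lemma_six {V : Type} [Fintype V] [DecidableEq V]
    (μ : V → ℝ) (d : V → ℕ) (hgen : IsGenTuple μ d) (hmono : DegMonotone μ d)
    (T : DirTree V) (hT : memR T d)
    (m m' : V) (hm : 1 < d m) (hm' : 1 < d m')
    (harc : T.parent m = m') (hmroot : m ≠ T.root)
    (hdeg : T.deg m' < T.deg m) :
    ∃ T' : DirTree V, memR T' d ∧ SWMaj (T'.fvec μ) (T.fvec μ) := by
  subst harc
  have hle : μ (T.parent m) ≤ μ m := by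
    refine hmono.1 _ _ hm' hm ?_
    rwa [← hT.2, ← hT.2]
  have hchild : (T.children m).card + 1 = T.deg m := by simp [DirTree.deg, hmroot]
  have hpos : 1 < T.deg (T.parent m) := by rwa [hT.2]
  obtain ⟨S, hS, hcard⟩ := Finset.exists_subset_card_eq
    (show T.deg (T.parent m) - 1 ≤ (T.children m).card by omega)
  obtain ⟨x, hx, hxS⟩ := Finset.exists_mem_notMem_of_card_lt_card
    (show S.card < (T.children m).card by omega)
  obtain ⟨l, hl, hleaf⟩ := T.exists_desc_children_eq_empty x
  have hdl : d l = 1 := by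
    refine le_antisymm ?_ (hgen.deg_pos l)
    rw [← hT.2, DirTree.deg, hleaf, Finset.card_empty]
    split_ifs <;> omega
  have hcard' : S.card + 1 = T.deg (T.parent m) := by omega
  refine ⟨T.exchange m hmroot S hS, ⟨?_, fun v => ?_⟩, ?_⟩
  · rw [T.exchange_root]
    split_ifs
    exacts [hm, hT.1]
  · rw [T.exchange_deg hmroot hS hcard', hT.2]
  · exact T.exchange_fvec_SWMaj hmroot hS hcard' (by rwa [hT.2]) hpos
      (T.exchange_f_parent_lt hmroot hS hgen.nonneg hle hx hxS hl (hmono.2 l hdl))
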